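/- arXiv:2407.19444 — 2 statements merged into one kernel-verified Lean document; each statement's English description precedes it below -/
import Mathlib

section
/- If a set R ⊆ ℕ is ({0, …, N−1})-nicely intersective (nicely intersective with respect to the Følner sequence F_N = {0, 1, …, N−1}), then R is a set of nice recurrence: for every measure preserving system (X, μ, T), every measurable A ⊆ X, and every ε > 0 there exists a nonzero r ∈ R with μ(A ∩ T^{−r}A) > μ(A)² − ε. -/
open MeasureTheory Filter
open scoped Classical symmDiff

/-- The upper density of `E ⊆ ℕ` with respect to a sequence `F` of finite subsets of `ℕ`. -/
noncomputable def upperDensity (F : ℕ → Finset ℕ) (E : Set ℕ) : ℝ :=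
  limsup (fun N : ℕ => (((F N).filter (· ∈ E)).card : ℝ) / (F N).card) atTop

/-- `F` is a Følner sequence in `ℕ`: `|F_N ∆ (F_N + t)| / |F_N| → 0` for every `t`. -/
def IsFolner (F : ℕ → Finset ℕ) : Prop :=
  ∀ t : ℕ,
    Tendsto (fun N : ℕ => (((F N) ∆ ((F N).image (· + t))).card : ℝ) / (F N).card)
      atTop (nhds 0)

/-- `R ⊆ ℕ` is a set of nice recurrence: for every measure preserving system `(X, μ, T)`,
every measurable `A ⊆ X` and every `ε > 0` there is a nonzero `r ∈ R` with
`μ(A ∩ T^{-r}A) > μ(A)² - ε`. -/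
def IsNiceRecurrenceSet (R : Set ℕ) : Prop :=
  ∀ (X : Type) (_ : MeasurableSpace X) (μ : Measure X) (T : X → X),
    IsProbabilityMeasure μ → Measurable T → MeasurePreserving T μ μ →
    ∀ A : Set X, MeasurableSet A → ∀ ε : ℝ, 0 < ε →
      ∃ r ∈ R, r ≠ 0 ∧ (μ (A ∩ T^[r] ⁻¹' A)).toReal > (μ A).toReal ^ 2 - ε

/-- `R ⊆ ℕ` is a set of recurrence: for every measure preserving system `(X, μ, T)` and
every measurable `A ⊆ X` with `μ(A) > 0` there is a nonzero `r ∈ R` with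
`μ(A ∩ T^{-r}A) > 0`. -/
def IsRecurrenceSet (R : Set ℕ) : Prop :=
  ∀ (X : Type) (_ : MeasurableSpace X) (μ : Measure X) (T : X → X),
    IsProbabilityMeasure μ → Measurable T → MeasurePreserving T μ μ →
    ∀ A : Set X, MeasurableSet A → 0 < μ A →
      ∃ r ∈ R, r ≠ 0 ∧ 0 < μ (A ∩ T^[r] ⁻¹' A)

/-- `R` is `(F_N)`-nicely intersective: for every `E ⊆ ℕ` and `ε > 0` there is a nonzero
`r ∈ R` with `d̄_F(E ∩ (E - r)) > d̄_F(E)² - ε`. -/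
def NicelyIntersective (F : ℕ → Finset ℕ) (R : Set ℕ) : Prop :=
  ∀ E : Set ℕ, ∀ ε : ℝ, 0 < ε →
    ∃ r ∈ R, r ≠ 0 ∧
      upperDensity F (E ∩ {m : ℕ | m + r ∈ E}) > (upperDensity F E) ^ 2 - ε

/-- `R` is `(F_N)`-intersective: every `E ⊆ ℕ` of positive upper density contains two
elements differing by a nonzero element of `R`. -/
def Intersective (F : ℕ → Finset ℕ) (R : Set ℕ) : Prop :=
  ∀ E : Set ℕ, 0 < upperDensity F E →
    ∃ r ∈ R, r ≠ 0 ∧ (E ∩ {m : ℕ | m + r ∈ E}).Nonempty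

/-- Greedy choice: given centred functions `h j r` bounded by `c j` (and vanishing for `j ≤ r`),
the points `x j` can be chosen so that every partial sum `∑ i < J, h i r (x i)` is of the order
of the square root of `∑ i < J, c i ^ 2`, as it would be for independent random points. -/
lemma exists_seq_sq_sum_le {X : Type*} [MeasurableSpace X] (μ : Measure X)
    [IsProbabilityMeasure μ] (h : ℕ → ℕ → X → ℝ) (c : ℕ → ℝ)
    (hint : ∀ j r, Integrable (h j r) μ) (hmean : ∀ j r, ∫ x, h j r x ∂μ = 0)
    (hbound : ∀ j r x, |h j r x| ≤ c j) (hzero : ∀ j r x, j ≤ r → h j r x = 0) :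
    ∃ x : ℕ → X, ∀ r J, (1 / 2 : ℝ) ^ r * (∑ i ∈ Finset.range J, h i r (x i)) ^ 2 ≤
      2 * ∑ i ∈ Finset.range J, c i ^ 2 := by
  have step : ∀ (j : ℕ) (S : ℕ → ℝ),
      ∃ x, ∑ r ∈ Finset.range j, (1 / 2 : ℝ) ^ r * S r * h j r x ≤ 0 := by
    intro j S
    have hi : Integrable (fun x => ∑ r ∈ Finset.range j, (1 / 2 : ℝ) ^ r * S r * h j r x) μ :=
      integrable_finsetSum _ fun r _ => (hint j r).const_mul _
    obtain ⟨x, hx⟩ := exists_le_integral hi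
    refine ⟨x, hx.trans_eq ?_⟩
    rw [integral_finsetSum _ fun r _ => (hint j r).const_mul _]
    simp [integral_const_mul, hmean]
  choose φ hφ using step
  let S : ℕ → ℕ → ℝ := fun J =>
    Nat.rec (fun _ => 0) (fun j s r => s r + h j r (φ j s)) J
  have hS : ∀ J r, S J r = ∑ i ∈ Finset.range J, h i r (φ i (S i)) := by
    intro J r
    induction J with
    | zero => simp [S]
    | succ J ih => rw [Finset.sum_range_succ, ← ih]
  have hS0 : ∀ J r, J ≤ r → S J r = 0 := by
    intro J r hJ
    rw [hS]
    refine Finset.sum_eq_zero fun i hi => hzero _ _ _ ?_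
    have := Finset.mem_range.1 hi
    omega
  have key : ∀ J, ∑ r ∈ Finset.range J, (1 / 2 : ℝ) ^ r * S J r ^ 2 ≤
      2 * ∑ i ∈ Finset.range J, c i ^ 2 := by
    intro J
    induction J with
    | zero => simp
    | succ J ih =>
      have hlast : S (J + 1) J = 0 := by
        change S J J + h J J _ = 0
        rw [hS0 J J le_rfl, hzero J J _ le_rfl, add_zero]
      have hsq : ∀ r ∈ Finset.range J, (1 / 2 : ℝ) ^ r * S (J + 1) r ^ 2 ≤
          (1 / 2 : ℝ) ^ r * S J r ^ 2 + 2 * ((1 / 2 : ℝ) ^ r * S J r * h J r (φ J (S J))) +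
            (1 / 2 : ℝ) ^ r * c J ^ 2 := by
        intro r _
        have h1 : S (J + 1) r = S J r + h J r (φ J (S J)) := rfl
        have h2 : h J r (φ J (S J)) ^ 2 ≤ c J ^ 2 := sq_le_sq' (abs_le.1 (hbound _ _ _)).1
          (abs_le.1 (hbound _ _ _)).2
        have h3 := mul_le_mul_of_nonneg_left h2 (by positivity : (0 : ℝ) ≤ (1 / 2 : ℝ) ^ r)
        rw [h1]
        linarith
      have hgeom := mul_le_mul_of_nonneg_right (sum_geometric_two_le J) (sq_nonneg (c J))
      have hsum := Finset.sum_le_sum hsq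
      rw [Finset.sum_add_distrib, Finset.sum_add_distrib, ← Finset.mul_sum,
        ← Finset.sum_mul] at hsum
      rw [Finset.sum_range_succ, Finset.sum_range_succ, hlast]
      linarith [hφ J (S J)]
  refine ⟨fun j => φ j (S j), fun r J => ?_⟩
  rw [← hS]
  rcases lt_or_ge r J with hr | hr
  · exact (Finset.single_le_sum (f := fun r => (1 / 2 : ℝ) ^ r * S J r ^ 2)
      (fun _ _ => by positivity) (Finset.mem_range.2 hr)).trans (key J)
  · rw [hS0 J r hr]
    have : 0 ≤ ∑ i ∈ Finset.range J, c i ^ 2 := Finset.sum_nonneg fun _ _ => sq_nonneg _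
    simpa using this

/-- Sums over an initial segment of squares, grouped by the value of `Nat.sqrt`. -/
lemma sum_range_mul_self (f : ℕ → ℝ) (J : ℕ) :
    ∑ n ∈ Finset.range (J * J), f n =
      ∑ j ∈ Finset.range J, ∑ n ∈ Finset.Ico (j * j) ((j + 1) * (j + 1)), f n := by
  induction J with
  | zero => simp
  | succ J ih =>
    rw [Finset.sum_range_succ, ← ih, Finset.sum_range_add_sum_Ico _ (by nlinarith)]

/-- If the sums of a sequence bounded by `1` over the blocks `[j², (j+1)²)` agree, up to a bounded
error, with terms whose partial sums are `O(J^(3/2))`, then its Cesàro means tend to `0`. -/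
lemma tendsto_cesaro_zero_of_blocks (e s : ℕ → ℝ) (a b : ℝ) (he : ∀ n, |e n| ≤ 1)
    (hs : ∀ j, |∑ n ∈ Finset.Ico (j * j) ((j + 1) * (j + 1)), e n - s j| ≤ a)
    (hS : ∀ J : ℕ, (∑ j ∈ Finset.range J, s j) ^ 2 ≤ b * (J : ℝ) ^ 3) :
    Tendsto (fun N : ℕ => (∑ n ∈ Finset.range N, e n) / N) atTop (nhds 0) := by
  have hsqrt : Tendsto Nat.sqrt atTop atTop :=
    tendsto_atTop_atTop.2 fun k => ⟨k * k, fun n hn => Nat.le_sqrt.2 hn⟩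
  have hinv : Tendsto (fun J : ℕ => (J : ℝ)⁻¹) atTop (nhds 0) := tendsto_inv_atTop_nhds_zero_nat
  have hlim : Tendsto (fun J : ℕ => (a + 2) * (J : ℝ)⁻¹ + √(b * (J : ℝ)⁻¹)) atTop (nhds 0) := by
    have h1 := (hinv.const_mul (a + 2)).add ((hinv.const_mul b).sqrt)
    simpa using h1
  refine squeeze_zero_norm' ?_ (hlim.comp hsqrt)
  filter_upwards [eventually_ge_atTop 1] with N hN
  set J := Nat.sqrt N with hJdef
  have hJ : 0 < J := Nat.sqrt_pos.2 hN
  have hJN : J * J ≤ N := Nat.sqrt_le N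
  have hNJ : N ≤ J * J + 2 * J := by
    have := Nat.sqrt_le_add N
    rw [← hJdef] at this
    omega
  have hJ' : (0 : ℝ) < J := by exact_mod_cast hJ
  have htail : |∑ n ∈ Finset.Ico (J * J) N, e n| ≤ 2 * J := by
    calc |∑ n ∈ Finset.Ico (J * J) N, e n| ≤ ∑ n ∈ Finset.Ico (J * J) N, |e n| :=
          Finset.abs_sum_le_sum_abs _ _
      _ ≤ ∑ n ∈ Finset.Ico (J * J) N, (1 : ℝ) := Finset.sum_le_sum fun n _ => he n
      _ = ((N - J * J : ℕ) : ℝ) := by simp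
      _ ≤ ((2 * J : ℕ) : ℝ) := by exact_mod_cast (by omega)
      _ = 2 * J := by push_cast; ring
  have hblocks : |∑ n ∈ Finset.range (J * J), e n - ∑ j ∈ Finset.range J, s j| ≤ a * J := by
    rw [sum_range_mul_self, ← Finset.sum_sub_distrib]
    calc _ ≤ ∑ j ∈ Finset.range J, |∑ n ∈ Finset.Ico (j * j) ((j + 1) * (j + 1)), e n - s j| :=
          Finset.abs_sum_le_sum_abs _ _
      _ ≤ ∑ j ∈ Finset.range J, a := Finset.sum_le_sum fun j _ => hs j
      _ = a * J := by simp [mul_comm]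
  have hmain : |∑ j ∈ Finset.range J, s j| ≤ √(b * (J : ℝ) ^ 3) := Real.abs_le_sqrt (hS J)
  have hroot : √(b * (J : ℝ) ^ 3) = √(b * (J : ℝ)⁻¹) * (J * J) := by
    rw [show b * (J : ℝ) ^ 3 = b * (J : ℝ)⁻¹ * (J * J) ^ 2 by field_simp,
      Real.sqrt_mul' _ (by positivity), Real.sqrt_sq (by positivity)]
  have hsplit := Finset.sum_range_add_sum_Ico e hJN
  have htotal : |∑ n ∈ Finset.range N, e n| ≤
      ((a + 2) * (J : ℝ)⁻¹ + √(b * (J : ℝ)⁻¹)) * (J * J) := by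
    have : ((a + 2) * (J : ℝ)⁻¹ + √(b * (J : ℝ)⁻¹)) * (J * J) =
        a * J + 2 * J + √(b * (J : ℝ) ^ 3) := by
      rw [hroot]; field_simp
    rw [this, ← hsplit]
    rw [abs_le] at *
    constructor <;> linarith
  have ha : 0 ≤ a := (abs_nonneg _).trans (hs 0)
  rw [Real.norm_eq_abs, abs_div, Nat.abs_cast, div_le_iff₀ (by exact_mod_cast hN)]
  refine htotal.trans (mul_le_mul_of_nonneg_left (by exact_mod_cast hJN) ?_)
  positivity

/-- Every set in a measure preserving system is modelled by a set of natural numbers: there is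
`E ⊆ ℕ` such that `E ∩ (E - r)` has natural density `μ (A ∩ T^{-r} A)` for every `r`. -/
lemma exists_set_tendsto_density {X : Type*} [MeasurableSpace X] (μ : Measure X)
    [IsProbabilityMeasure μ] {T : X → X} (hT : MeasurePreserving T μ μ) {A : Set X}
    (hA : MeasurableSet A) :
    ∃ E : Set ℕ, ∀ r : ℕ, Tendsto (fun N : ℕ =>
      (((Finset.range N).filter (· ∈ E ∩ {m : ℕ | m + r ∈ E})).card : ℝ) / (Finset.range N).card)
      atTop (nhds (μ.real (A ∩ T^[r] ⁻¹' A))) := by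
  let B : ℕ → Set X := fun r => A ∩ T^[r] ⁻¹' A
  have hB : ∀ r, MeasurableSet (B r) := fun r =>
    hA.inter ((hT.iterate r).measurable hA)
  let f : ℕ → ℕ → X → ℝ := fun n r x => (T^[n] ⁻¹' B r).indicator 1 x - μ.real (B r)
  have hmB : ∀ n r, MeasurableSet (T^[n] ⁻¹' B r) := fun n r =>
    (hT.iterate n).measurable (hB r)
  have hind : ∀ n r, Integrable ((T^[n] ⁻¹' B r).indicator (1 : X → ℝ)) μ := fun n r =>
    (integrable_const (1 : ℝ)).indicator (hmB n r)
  have hfint : ∀ n r, Integrable (f n r) μ := fun n r => (hind n r).sub (integrable_const _)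
  have hfmean : ∀ n r, ∫ x, f n r x ∂μ = 0 := by
    intro n r
    have h1 : μ.real (T^[n] ⁻¹' B r) = μ.real (B r) :=
      (hT.iterate n).measureReal_preimage (hB r).nullMeasurableSet
    simp only [f]
    rw [integral_sub (hind n r) (integrable_const _), integral_indicator_one (hmB n r), h1]
    simp
  have hdev : ∀ (p : Prop) [Decidable p] (r : ℕ), |(if p then (1 : ℝ) else 0) - μ.real (B r)| ≤ 1 := by
    intro p _ r
    have h0 : 0 ≤ μ.real (B r) := measureReal_nonneg
    have h1 : μ.real (B r) ≤ 1 := measureReal_le_one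
    rw [abs_le]
    split_ifs <;> constructor <;> linarith
  have hfapply : ∀ n r x, f n r x =
      (if T^[n] x ∈ A ∧ T^[n + r] x ∈ A then (1 : ℝ) else 0) - μ.real (B r) := by
    intro n r x
    simp only [f, B, Set.indicator_apply, Set.mem_preimage, Set.mem_inter_iff, Pi.one_apply,
      ← Function.iterate_add_apply, add_comm r n]
  have hfbound : ∀ n r x, |f n r x| ≤ 1 := by
    intro n r x
    rw [hfapply]
    exact hdev _ r
  let I : ℕ → Finset ℕ := fun j => Finset.Ico (j * j) ((j + 1) * (j + 1))
  have hI : ∀ j, ((I j).card : ℝ) = 2 * j + 1 := by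
    intro j
    rw [Nat.card_Ico, Nat.cast_sub (by nlinarith)]
    push_cast
    ring
  have hIsum : ∀ (j : ℕ) (u : ℕ → ℝ), (∀ n, |u n| ≤ 1) → |∑ n ∈ I j, u n| ≤ 2 * j + 1 := by
    intro j u hu
    calc |∑ n ∈ I j, u n| ≤ ∑ n ∈ I j, |u n| := Finset.abs_sum_le_sum_abs _ _
      _ ≤ ∑ n ∈ I j, (1 : ℝ) := Finset.sum_le_sum fun n _ => hu n
      _ = 2 * j + 1 := by rw [← hI]; simp
  let h : ℕ → ℕ → X → ℝ := fun j r x => if r < j then ∑ n ∈ I j, f n r x else 0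
  obtain ⟨x, hx⟩ := exists_seq_sq_sum_le μ h (fun j => 2 * (j : ℝ) + 1)
    (by
      intro j r
      by_cases hr : r < j
      · simpa only [h, hr, if_true] using integrable_finsetSum _ fun n _ => hfint n r
      · simp [h, hr])
    (by
      intro j r
      by_cases hr : r < j
      · simp only [h, hr, if_true]
        rw [integral_finsetSum _ fun n _ => hfint n r]
        simp [hfmean]
      · simp [h, hr])
    (by
      intro j r x
      by_cases hr : r < j
      · simpa only [h, hr, if_true] using hIsum j _ fun n => hfbound n r x
      · simp only [h, hr, if_false, abs_zero]
        positivity)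
    (by
      intro j r x hr
      simp [h, not_lt.2 hr])
  refine ⟨{n | T^[n] (x n.sqrt) ∈ A}, fun r => ?_⟩
  set E : Set ℕ := {n | T^[n] (x n.sqrt) ∈ A} with hE
  let e : ℕ → ℝ := fun n => (if n ∈ E ∩ {m : ℕ | m + r ∈ E} then (1 : ℝ) else 0) - μ.real (B r)
  have he : ∀ n, |e n| ≤ 1 := fun n => hdev _ r
  have heq : ∀ j n, j * j ≤ n → n + r < (j + 1) * (j + 1) → e n = f n r (x j) := by
    intro j n h1 h2
    have hn : n.sqrt = j := (Nat.eq_sqrt.2 ⟨h1, by omega⟩).symm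
    have hnr : (n + r).sqrt = j := (Nat.eq_sqrt.2 ⟨by omega, h2⟩).symm
    simp only [e, hE, hfapply, Set.mem_inter_iff, Set.mem_ofPred_eq, hn, hnr]
  have hblock : ∀ j, |∑ n ∈ I j, e n - h j r (x j)| ≤ 2 * (r : ℝ) + 1 := by
    intro j
    by_cases hr : r < j
    · simp only [h, hr, if_true]
      rw [← Finset.sum_sub_distrib]
      have hrest : ∀ n ∈ I j, |e n - f n r (x j)| ≤
          if n ∈ Finset.Ico ((j + 1) * (j + 1) - r) ((j + 1) * (j + 1)) then 2 else 0 := by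
        intro n hn
        obtain ⟨h1, h2⟩ := Finset.mem_Ico.1 hn
        split_ifs with hmem
        · exact (abs_sub _ _).trans (by linarith [he n, hfbound n r (x j)])
        · rw [Finset.mem_Ico] at hmem
          rw [heq j n h1 (by omega)]
          simp
      calc |∑ n ∈ I j, (e n - f n r (x j))| ≤ ∑ n ∈ I j, |e n - f n r (x j)| :=
            Finset.abs_sum_le_sum_abs _ _
        _ ≤ ∑ n ∈ I j, if n ∈ Finset.Ico ((j + 1) * (j + 1) - r) ((j + 1) * (j + 1))
              then (2 : ℝ) else 0 := Finset.sum_le_sum hrest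
        _ = ∑ n ∈ (I j).filter (· ∈ Finset.Ico ((j + 1) * (j + 1) - r) ((j + 1) * (j + 1))),
              (2 : ℝ) := by rw [Finset.sum_filter]
        _ ≤ ∑ n ∈ Finset.Ico ((j + 1) * (j + 1) - r) ((j + 1) * (j + 1)), (2 : ℝ) :=
            Finset.sum_le_sum_of_subset_of_nonneg
              (fun n hn => (Finset.mem_filter.1 hn).2) fun _ _ _ => by norm_num
        _ = (((j + 1) * (j + 1) - ((j + 1) * (j + 1) - r) : ℕ) : ℝ) * 2 := by simp
        _ ≤ (r : ℝ) * 2 := by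
            gcongr
            omega
        _ ≤ 2 * (r : ℝ) + 1 := by linarith
    · simp only [h, hr, if_false, sub_zero]
      have hjr : (j : ℝ) ≤ r := by exact_mod_cast not_lt.1 hr
      exact (hIsum j e he).trans (by linarith)
  have hsums : ∀ J : ℕ, (∑ j ∈ Finset.range J, h j r (x j)) ^ 2 ≤ 2 ^ r * 8 * (J : ℝ) ^ 3 := by
    intro J
    have hc : ∑ i ∈ Finset.range J, (2 * (i : ℝ) + 1) ^ 2 ≤ 4 * (J : ℝ) ^ 3 := by
      calc ∑ i ∈ Finset.range J, (2 * (i : ℝ) + 1) ^ 2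
          ≤ ∑ i ∈ Finset.range J, (2 * (J : ℝ)) ^ 2 := by
            refine Finset.sum_le_sum fun i hi => ?_
            have : (i : ℝ) + 1 ≤ J := by exact_mod_cast Finset.mem_range.1 hi
            gcongr
            linarith
        _ = 4 * (J : ℝ) ^ 3 := by
            rw [Finset.sum_const, Finset.card_range, nsmul_eq_mul]
            ring
    have h1 := (hx r J).trans (mul_le_mul_of_nonneg_left hc zero_le_two)
    have h2 := mul_le_mul_of_nonneg_left h1 (by positivity : (0 : ℝ) ≤ 2 ^ r)
    rw [← mul_assoc, ← mul_pow] at h2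
    norm_num at h2
    linarith
  have hlim := (tendsto_cesaro_zero_of_blocks e (fun j => h j r (x j)) _ _ he hblock hsums).add_const
    (μ.real (B r))
  rw [zero_add] at hlim
  refine hlim.congr' ?_
  filter_upwards [eventually_ge_atTop 1] with N hN
  have hN' : (N : ℝ) ≠ 0 := by positivity
  simp only [e]
  rw [Finset.sum_sub_distrib, Finset.sum_boole, Finset.sum_const, Finset.card_range, nsmul_eq_mul,
    sub_div, mul_div_cancel_left₀ _ hN', sub_add_cancel]

/-- If `R` is `({0, …, N-1})`-nicely intersective, then `R` is a set of nice recurrence. -/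
theorem nicelyIntersective_range_isNiceRecurrence (R : Set ℕ)
    (hR : NicelyIntersective (fun N => Finset.range N) R) : IsNiceRecurrenceSet R := by
  intro X _ μ T _ _ hT A hA ε hε
  obtain ⟨E, hE⟩ := exists_set_tendsto_density μ hT hA
  obtain ⟨r, hr, hr0, hlt⟩ := hR E ε hε
  have hdens : upperDensity (fun N => Finset.range N) E = μ.real A := by
    simpa [upperDensity] using (hE 0).limsup_eq
  rw [hdens] at hlt
  refine ⟨r, hr, hr0, hlt.trans_eq ?_⟩
  rw [← measureReal_def, ← (hE r).limsup_eq, upperDensity]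
  congr!
end

section
/- If R ⊆ ℕ is a set of recurrence, then for every Følner sequence (F_N) in ℕ the set R is (F_N)-intersective: for every E ⊆ ℕ with d̄_{(F_N)}(E) > 0 there exists a nonzero r ∈ R such that E ∩ (E − r) ≠ ∅. -/
open MeasureTheory Filter
open scoped Classical symmDiff

section Empirical

variable {X : Type*} [MeasurableSpace X]

/-- The uniform probability measure on the points `x n` with `n ∈ s`, counted with
multiplicity. -/
noncomputable def empiricalMeasure (x : ℕ → X) (s : Finset ℕ) : Measure X :=
  (s.card : ENNReal)⁻¹ • ∑ n ∈ s, Measure.dirac (x n)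

theorem empiricalMeasure_apply (x : ℕ → X) (s : Finset ℕ) {A : Set X} (hA : MeasurableSet A) :
    empiricalMeasure x s A = (s.card : ENNReal)⁻¹ * (s.filter (x · ∈ A)).card := by
  simp [empiricalMeasure, Measure.dirac_apply' _ hA, Set.indicator_apply,
    Finset.sum_boole]

theorem isProbabilityMeasure_empiricalMeasure (x : ℕ → X) {s : Finset ℕ} (hs : s.Nonempty) :
    IsProbabilityMeasure (empiricalMeasure x s) where
  measure_univ := by
    rw [empiricalMeasure_apply x s MeasurableSet.univ]
    simpa using ENNReal.inv_mul_cancel (by simpa using hs.ne_empty) (ENNReal.natCast_ne_top _)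

theorem integral_empiricalMeasure (x : ℕ → X) (s : Finset ℕ) {f : X → ℝ}
    (hf : StronglyMeasurable f) :
    ∫ y, f y ∂empiricalMeasure x s = (∑ n ∈ s, f (x n)) / s.card := by
  rw [empiricalMeasure, integral_smul_measure, integral_finsetSum_measure]
  · simp [integral_dirac' _ _ hf, div_eq_inv_mul]
  · exact fun n _ => integrable_dirac' hf (by simp)

end Empirical

theorem abs_sum_sub_sum_le_card_symmDiff {ι : Type*} [DecidableEq ι] (s t : Finset ι) {g : ι → ℝ}
    {C : ℝ} (hg : ∀ i, |g i| ≤ C) :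
    |∑ i ∈ s, g i - ∑ i ∈ t, g i| ≤ C * (s ∆ t).card := by
  rw [← Finset.sum_sdiff_sub_sum_sdiff]
  have key (u : Finset ι) : |∑ i ∈ u, g i| ≤ u.card * C := by
    simpa using (Finset.abs_sum_le_sum_abs _ _).trans
      (Finset.sum_le_card_nsmul u _ C fun i _ => hg i)
  have hcard : (s ∆ t).card = (s \ t).card + (t \ s).card :=
    Finset.card_union_of_disjoint disjoint_sdiff_sdiff
  rw [hcard]
  push_cast
  linarith [abs_sub (∑ i ∈ s \ t, g i) (∑ i ∈ t \ s, g i), key (s \ t), key (t \ s)]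

/-- A weak limit of empirical measures along an orbit of a continuous map, taken over a Følner
sequence, is invariant. -/
theorem measurePreserving_of_tendsto_empiricalMeasure {X : Type*} [TopologicalSpace X]
    [MeasurableSpace X] [BorelSpace X] [HasOuterApproxClosed X]
    {T : X → X} (hT : Continuous T) {x : ℕ → X} (hx : ∀ n, x (n + 1) = T (x n))
    {F : ℕ → Finset ℕ} (hF : IsFolner F) {L : Filter ℕ} [L.NeBot] (hL : L ≤ atTop)
    {ν : ℕ → ProbabilityMeasure X} (hν : ∀ N, (ν N : Measure X) = empiricalMeasure x (F N))
    {μ : ProbabilityMeasure X} (hμ : Tendsto ν L (nhds μ)) :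
    MeasurePreserving T (μ : Measure X) μ := by
  refine ⟨hT.measurable, ?_⟩
  have hmap : Tendsto (fun N => (ν N).map hT.measurable.aemeasurable) L (nhds μ) := by
    rw [ProbabilityMeasure.tendsto_iff_forall_integral_tendsto] at hμ ⊢
    intro f
    have hdiff : Tendsto (fun N => ∫ y, f y ∂((ν N).map hT.measurable.aemeasurable : Measure X)
        - ∫ y, f y ∂(ν N : Measure X)) L (nhds 0) := by
      have h0 : Tendsto (fun N =>
          ‖f‖ * ((((F N) ∆ ((F N).image (· + 1))).card : ℝ) / (F N).card)) L (nhds 0) := by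
        simpa using ((hF 1).mono_left hL).const_mul ‖f‖
      refine squeeze_zero_norm (fun N => ?_) h0
      rw [ProbabilityMeasure.toMeasure_map,
        integral_map hT.measurable.aemeasurable f.continuous.aestronglyMeasurable, hν,
        integral_empiricalMeasure _ _ f.continuous.stronglyMeasurable,
        integral_empiricalMeasure _ _ (f := fun y => f (T y))
          (f.continuous.comp hT).stronglyMeasurable,
        ← sub_div, Real.norm_eq_abs, abs_div, Nat.abs_cast, ← mul_div_assoc, abs_sub_comm]
      have himage : ∑ n ∈ F N, f (T (x n)) = ∑ n ∈ (F N).image (· + 1), f (x n) := by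
        rw [Finset.sum_image fun a _ b _ h => Nat.succ_injective h]
        simp only [hx]
      rw [himage]
      gcongr
      exact abs_sum_sub_sum_le_card_symmDiff _ _ fun n => f.norm_coe_le_norm (x n)
    simpa using hdiff.add (hμ f)
  have hmap' := ProbabilityMeasure.tendsto_map_of_tendsto_of_continuous ν μ hμ hT
  simpa using congrArg ProbabilityMeasure.toMeasure (tendsto_nhds_unique hmap' hmap)

theorem frequently_lt_density_of_lt_upperDensity {F : ℕ → Finset ℕ} {E : Set ℕ} {c : ℝ}
    (h : c < upperDensity F E) :
    ∃ᶠ N in atTop, c < (((F N).filter (· ∈ E)).card : ℝ) / (F N).card :=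
  frequently_lt_of_lt_limsup
    (isCoboundedUnder_le_of_le atTop (x := 0) fun N => by positivity) h

/-- Furstenberg's correspondence principle: a set of positive upper density is the set of visit
times of some orbit to a clopen set of positive measure in a measure preserving system, in which
open sets missed by the orbit are null. -/
theorem exists_measurePreserving_of_upperDensity_pos {F : ℕ → Finset ℕ} (hF : IsFolner F)
    {E : Set ℕ} (hE : 0 < upperDensity F E) :
    ∃ (μ : ProbabilityMeasure (ℕ → Bool)) (T : (ℕ → Bool) → ℕ → Bool) (x : ℕ → ℕ → Bool)
      (A : Set (ℕ → Bool)), Continuous T ∧ MeasurePreserving T (μ : Measure (ℕ → Bool)) μ ∧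
      (∀ n r, T^[r] (x n) = x (n + r)) ∧ IsClopen A ∧ 0 < (μ : Measure (ℕ → Bool)) A ∧
      (∀ n, x n ∈ A ↔ n ∈ E) ∧
      ∀ U, IsOpen U → (∀ n, x n ∉ U) → (μ : Measure (ℕ → Bool)) U = 0 := by
  obtain ⟨c, hc0, hc⟩ := exists_between hE
  obtain ⟨φ, hφ, hφc⟩ :=
    extraction_of_frequently_atTop (frequently_lt_density_of_lt_upperDensity hc)
  have hne (k : ℕ) : (F (φ k)).Nonempty := by
    rw [Finset.nonempty_iff_ne_empty]
    intro h
    simpa [h, hc0.le.not_gt] using hφc k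
  have hFφ : IsFolner fun k => F (φ k) := fun t => (hF t).comp hφ.tendsto_atTop
  let T : (ℕ → Bool) → ℕ → Bool := fun y i => y (i + 1)
  let x : ℕ → ℕ → Bool := fun n i => decide (n + i ∈ E)
  let A : Set (ℕ → Bool) := {y | y 0 = true}
  have hTc : Continuous T := continuous_pi fun i => continuous_apply (i + 1)
  have hx (n : ℕ) : x (n + 1) = T (x n) := by
    ext i
    simp [x, T, add_assoc, add_comm 1 i]
  have hiter (n r : ℕ) : T^[r] (x n) = x (n + r) := by
    induction r with
    | zero => rfl
    | succ r ih => rw [Function.iterate_succ_apply', ih, ← hx, add_assoc]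
  have hA : IsClopen A := (isClopen_discrete {true}).preimage (continuous_apply 0)
  have hxA (n : ℕ) : x n ∈ A ↔ n ∈ E := by simp [x, A]
  let ν : ℕ → ProbabilityMeasure (ℕ → Bool) := fun k =>
    ⟨empiricalMeasure x (F (φ k)), isProbabilityMeasure_empiricalMeasure x (hne k)⟩
  have hν (k : ℕ) : (ν k : Measure (ℕ → Bool)) = empiricalMeasure x (F (φ k)) := rfl
  obtain ⟨L, hL⟩ := Ultrafilter.exists_le (atTop : Filter ℕ)
  obtain ⟨μ, -, hμ⟩ := isCompact_univ.ultrafilter_le_nhds (L.map ν) (by simp)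
  replace hμ : Tendsto ν L (nhds μ) := hμ
  refine ⟨μ, T, x, A, hTc, measurePreserving_of_tendsto_empiricalMeasure hTc hx hFφ hL hν hμ,
    hiter, hA, ?_, hxA, fun U hU hxU => ?_⟩
  · have hlim := ProbabilityMeasure.tendsto_measure_of_null_frontier_of_tendsto' hμ
      (E := A) (by simp [hA.frontier_eq])
    refine (ENNReal.ofReal_pos.2 hc0).trans_le (ge_of_tendsto' hlim fun k => ?_)
    rw [hν, empiricalMeasure_apply x _ hA.isOpen.measurableSet]
    simp only [hxA]
    rw [mul_comm, ← div_eq_mul_inv]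
    refine (ENNReal.ofReal_le_ofReal (hφc k).le).trans_eq ?_
    rw [ENNReal.ofReal_div_of_pos (by exact_mod_cast (hne k).card_pos)]
    simp
  · have h := ProbabilityMeasure.le_liminf_measure_open_of_tendsto hμ hU
    simpa [hν, empiricalMeasure_apply x _ hU.measurableSet, hxU] using h

/-- A set of recurrence is `(F_N)`-intersective for every Følner sequence `(F_N)`. -/
theorem recurrence_intersective (R : Set ℕ) (hR : IsRecurrenceSet R)
    (F : ℕ → Finset ℕ) (hF : IsFolner F) : Intersective F R := by
  intro E hE
  obtain ⟨μ, T, x, A, hTc, hT, hiter, hA, hμA, hxA, hnull⟩ :=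
    exists_measurePreserving_of_upperDensity_pos hF hE
  obtain ⟨r, hr, hr0, hpos⟩ :=
    hR (ℕ → Bool) _ μ T inferInstance hTc.measurable hT A hA.isOpen.measurableSet hμA
  refine ⟨r, hr, hr0, ?_⟩
  by_contra hempty
  refine hpos.ne' (hnull _ (hA.isOpen.inter (hA.isOpen.preimage (hTc.iterate r))) ?_)
  rintro n ⟨hn, hnr⟩
  rw [Set.mem_preimage, hiter, hxA] at hnr
  exact hempty ⟨n, (hxA n).1 hn, hnr⟩
end
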